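/- arXiv:1607.03836 — 3 statements merged into one kernel-verified Lean document; each statement's English description precedes it below -/
import Mathlib

section
/- Let α = (α₁, ..., αₙ) be a nonincreasing sequence of nonnegative integers with n-1 ≥ α₁ ≥ ... ≥ αₙ ≥ 0 and even sum s = ∑αᵢ. If (α₁ - αₙ) · ((n - α₁ - 1)/(n·α₁ - s) + αₙ/(s - n·αₙ)) ≥ 1 (with n·α₁ > s and s > n·αₙ), then α is graphic, i.e., it is the degree sequence of a simple graph. -/
/-- A sequence `d` on `Fin n` is graphic if some simple graph on `n` vertices
realizes it as its degree sequence. -/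
def IsGraphic {n : ℕ} (d : Fin n → ℕ) : Prop :=
  ∃ (G : SimpleGraph (Fin n)) (_ : DecidableRel G.Adj), ∀ i, G.degree i = d i

open Classical in
noncomputable def dg {n : ℕ} (G : SimpleGraph (Fin n)) (v : Fin n) : ℕ :=
  (Finset.univ.filter (fun w => G.Adj v w)).card

open Classical in
theorem dg_add {n : ℕ} (G : SimpleGraph (Fin n)) (u v : Fin n) (huv : u ≠ v) (h : ¬ G.Adj u v) :
    ∃ G' : SimpleGraph (Fin n),
      (∀ x y, G'.Adj x y ↔ G.Adj x y ∨ (x = u ∧ y = v) ∨ (x = v ∧ y = u)) ∧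
      (∀ w, dg G' w = dg G w + (if w = u then 1 else 0) + (if w = v then 1 else 0)) := by
  have h' : ¬ G.Adj v u := fun e => h e.symm
  refine ⟨⟨fun x y => G.Adj x y ∨ (x = u ∧ y = v) ∨ (x = v ∧ y = u), ⟨?_⟩, ⟨?_⟩⟩, fun x y => Iff.rfl, ?_⟩
  · intro x y hxy
    rcases hxy with e | e | e
    · exact Or.inl e.symm
    · exact Or.inr (Or.inr ⟨e.2, e.1⟩)
    · exact Or.inr (Or.inl ⟨e.2, e.1⟩)
  · rintro x (e | ⟨e, f⟩ | ⟨e, f⟩)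
    · exact G.loopless.irrefl x e
    · exact huv (e ▸ f)
    · exact huv (f ▸ e)
  · intro w
    unfold dg
    by_cases hu : w = u
    · subst hu
      rw [if_pos rfl, if_neg huv, add_zero, ← Finset.card_insert_of_notMem (a := v)]
      · congr 1; ext x; simp; grind
      · simpa using h
    · by_cases hv : w = v
      · subst hv
        rw [if_pos rfl, if_neg hu, add_zero, ← Finset.card_insert_of_notMem (a := u)]
        · congr 1; ext x; simp; grind
        · simpa using h'
      · simp [hu, hv]

open Classical in
theorem dg_del {n : ℕ} (G : SimpleGraph (Fin n)) (u v : Fin n) (h : G.Adj u v) :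
    ∃ G' : SimpleGraph (Fin n),
      (∀ x y, G'.Adj x y ↔ G.Adj x y ∧ ¬ (x = u ∧ y = v) ∧ ¬ (x = v ∧ y = u)) ∧
      (∀ w, dg G' w + (if w = u then 1 else 0) + (if w = v then 1 else 0) = dg G w) := by
  have huv : u ≠ v := h.ne
  have h' : G.Adj v u := h.symm
  let G' : SimpleGraph (Fin n) :=
    ⟨fun x y => G.Adj x y ∧ ¬ (x = u ∧ y = v) ∧ ¬ (x = v ∧ y = u), ⟨by
      intro x y hxy
      exact ⟨hxy.1.symm, fun e => hxy.2.2 ⟨e.2, e.1⟩, fun e => hxy.2.1 ⟨e.2, e.1⟩⟩⟩,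
     ⟨fun x e => G.loopless.irrefl x e.1⟩⟩
  have hG' : ∀ x y, G'.Adj x y ↔ G.Adj x y ∧ ¬ (x = u ∧ y = v) ∧ ¬ (x = v ∧ y = u) :=
    fun x y => Iff.rfl
  refine ⟨G', hG', ?_⟩
  obtain ⟨G2, h2, d2⟩ := dg_add G' u v huv (by simp [hG'])
  have : G2 = G := by
    ext x y
    rw [h2, hG']
    grind
  intro w
  rw [← this, d2]

open Classical in
theorem exists_nbr {n : ℕ} (G : SimpleGraph (Fin n)) (i j : Fin n) (h : dg G j < dg G i) :
    ∃ u, G.Adj i u ∧ u ≠ j ∧ ¬ G.Adj j u := by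
  by_contra hc
  push Not at hc
  by_cases hij : G.Adj i j
  · have hs : (Finset.univ.filter (fun w => G.Adj i w)).erase j ⊆
        (Finset.univ.filter (fun w => G.Adj j w)).erase i := by
      intro u hu
      simp only [Finset.mem_erase, Finset.mem_filter, Finset.mem_univ, true_and] at hu ⊢
      exact ⟨hu.2.ne', hc u hu.2 hu.1⟩
    have := Finset.card_le_card hs
    rw [Finset.card_erase_of_mem (by simpa using hij),
      Finset.card_erase_of_mem (by simpa using hij.symm)] at this
    have h1 : 0 < dg G j := Finset.card_pos.2 ⟨i, by simpa using hij.symm⟩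
    unfold dg at h h1
    omega
  · have hs : (Finset.univ.filter (fun w => G.Adj i w)) ⊆
        (Finset.univ.filter (fun w => G.Adj j w)) := by
      intro u hu
      simp only [Finset.mem_filter, Finset.mem_univ, true_and] at hu ⊢
      exact hc u hu (by rintro rfl; exact hij hu)
    have := Finset.card_le_card hs
    unfold dg at h
    omega

open Classical in
theorem even_dg {n : ℕ} (G : SimpleGraph (Fin n)) : Even (∑ i, dg G i) := by
  have h := G.sum_degrees_eq_twice_card_edges
  have : ∑ i, dg G i = ∑ i, G.degree i := by
    refine Finset.sum_congr rfl fun i _ => ?_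
    rw [← SimpleGraph.card_neighborFinset_eq_degree, SimpleGraph.neighborFinset_eq_filter]
    rfl
  rw [this, h]
  exact even_two_mul _

def SubReal {n : ℕ} (d : Fin n → ℕ) (r : Fin n) (G : SimpleGraph (Fin n)) : Prop :=
  (∀ i, dg G i ≤ d i) ∧ (∀ i, i < r → dg G i = d i) ∧
    (∀ i j, r < i → r < j → ¬ G.Adj i j)

open Classical in
theorem final_count {n : ℕ} (d : Fin n → ℕ) (r : Fin n) (G : SimpleGraph (Fin n))
    (hcl : ∀ i j, i ≤ r → j ≤ r → i ≠ j → G.Adj i j)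
    (hind : ∀ i j, r < i → r < j → ¬ G.Adj i j)
    (hmin : ∀ k, r < k → dg G k = min (r.val + 1) (d k)) :
    ∑ i with i ≤ r, dg G i = (r.val + 1) * r.val + ∑ i with r < i, min (r.val + 1) (d i) := by
  have hcard : (Finset.univ.filter (fun i : Fin n => i ≤ r)).card = r.val + 1 := by
    have : (Finset.univ.filter (fun i : Fin n => i ≤ r)) = Finset.Iic r := by ext; simp
    rw [this, Fin.card_Iic]
  have h1 : ∀ i, i ≤ r → dg G i = r.val + ∑ k with r < k, (if G.Adj i k then 1 else 0) := by
    intro i hi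
    unfold dg
    rw [← Finset.card_filter, Finset.filter_filter]
    have : (Finset.univ.filter (fun w => G.Adj i w)) =
      ((Finset.univ.filter (fun j : Fin n => j ≤ r)).erase i) ∪
        (Finset.univ.filter (fun k => r < k ∧ G.Adj i k)) := by
      ext x
      simp only [Finset.mem_filter, Finset.mem_univ, true_and, Finset.mem_union, Finset.mem_erase]
      constructor
      · intro h
        rcases le_or_gt x r with hx | hx
        · exact Or.inl ⟨h.ne', hx⟩
        · exact Or.inr ⟨hx, h⟩
      · rintro (⟨h, hx⟩ | h)
        · exact hcl i x hi hx (Ne.symm h)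
        · exact h.2
    rw [this, Finset.card_union_of_disjoint, Finset.card_erase_of_mem (by simpa using hi), hcard]
    · simp
    · rw [Finset.disjoint_left]
      intro x hx hx'
      simp only [Finset.mem_filter, Finset.mem_univ, true_and, Finset.mem_erase] at hx hx'
      exact absurd hx'.1 (not_lt.2 hx.2)
  have h2 : ∀ k, r < k → dg G k = ∑ i with i ≤ r, (if G.Adj i k then 1 else 0) := by
    intro k hk
    unfold dg
    rw [← Finset.card_filter, Finset.filter_filter]
    congr 1
    ext x
    simp only [Finset.mem_filter, Finset.mem_univ, true_and]
    constructor
    · intro h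
      exact ⟨not_lt.1 fun hx => hind k x hk hx h, h.symm⟩
    · intro h
      exact h.2.symm
  rw [Finset.sum_congr rfl (fun i hi => h1 i (by simpa using hi)), Finset.sum_add_distrib,
    Finset.sum_const, hcard, Finset.sum_comm, smul_eq_mul]
  congr 1
  refine Finset.sum_congr rfl fun k hk => ?_
  have hk' : r < k := by simpa using hk
  rw [← h2 k hk', hmin k hk']

set_option maxHeartbeats 1000000 in
open Classical in
theorem improve {n : ℕ} (d : Fin n → ℕ) (hd : Antitone d) (he : Even (∑ i, d i))
    (r : Fin n)
    (hEG : ∑ i with i ≤ r, d i ≤ (r.val + 1) * r.val + ∑ i with r < i, min (r.val + 1) (d i))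
    (G : SimpleGraph (Fin n)) (hG : SubReal d r G) (hr : dg G r < d r) :
    ∃ G', SubReal d r G' ∧ dg G r < dg G' r := by
  obtain ⟨hle, heq, hind⟩ := hG
  have hbig : ∀ i, i < r → dg G r < dg G i := by
    intro i hi
    rw [heq i hi]
    exact lt_of_lt_of_le hr (hd hi.le)
  -- case 0
  by_cases c0 : ∃ k, r < k ∧ dg G k < d k ∧ ¬ G.Adj r k
  · obtain ⟨k, hk, hkd, hkr⟩ := c0
    obtain ⟨G1, a1, d1⟩ := dg_add G r k hk.ne hkr
    refine ⟨G1, ⟨?_, ?_, ?_⟩, ?_⟩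
    · intro i; have := d1 i; have := hle i; grind
    · intro i hi; have := d1 i; have := heq i hi; grind
    · intro i j hi hj; have := hind i j hi hj; rw [a1]; grind
    · have := d1 r; grind
  push Not at c0
  -- case 1
  by_cases c1 : ∃ i, i < r ∧ ¬ G.Adj r i
  · obtain ⟨i, hi, hir⟩ := c1
    obtain ⟨u, hu, hur, hru⟩ := exists_nbr G i r (hbig i hi)
    have hui : u ≠ i := hu.ne'
    obtain ⟨G1, a1, d1⟩ := dg_del G i u hu
    obtain ⟨G2, a2, d2⟩ := dg_add G1 r u hur.symm (by rw [a1]; tauto)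
    obtain ⟨G3, a3, d3⟩ := dg_add G2 r i hi.ne' (by rw [a2, a1]; grind)
    by_cases h2 : dg G r + 2 ≤ d r
    · refine ⟨G3, ⟨?_, ?_, ?_⟩, ?_⟩
      · intro x; have := d1 x; have := d2 x; have := d3 x; have := hle x; grind
      · intro x hx; have := d1 x; have := d2 x; have := d3 x; have := heq x hx; grind
      · intro x y hx hy; have := hind x y hx hy; rw [a3, a2, a1]; grind
      · have := d1 r; have := d2 r; have := d3 r; grind
    · have hk : ∃ k, r < k ∧ dg G k < d k := by
        by_contra hc
        push Not at hc
        have e : ∑ x, d x = ∑ x, dg G x + 1 := by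
          rw [← Finset.add_sum_erase _ _ (Finset.mem_univ r),
            ← Finset.add_sum_erase _ (dg G) (Finset.mem_univ r)]
          have : ∑ x ∈ Finset.univ.erase r, d x = ∑ x ∈ Finset.univ.erase r, dg G x := by
            refine Finset.sum_congr rfl fun x hx => ?_
            have hx' : x ≠ r := by simpa using hx
            rcases lt_or_gt_of_ne hx' with h | h
            · exact (heq x h).symm
            · exact le_antisymm (hc x h) (hle x)
          omega
        have := even_dg G
        rw [e] at he
        grind
      obtain ⟨k, hk, hkd⟩ := hk
      have hrk := c0 k hk hkd
      have hku : k ≠ u := by rintro rfl; exact hru hrk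
      have hki : k ≠ i := (hi.trans hk).ne'
      obtain ⟨G4, a4, d4⟩ := dg_del G3 r k (by rw [a3, a2, a1]; grind)
      refine ⟨G4, ⟨?_, ?_, ?_⟩, ?_⟩
      · intro x; have := d1 x; have := d2 x; have := d3 x; have := d4 x; have := hle x; grind
      · intro x hx; have := d1 x; have := d2 x; have := d3 x; have := d4 x; have := heq x hx; grind
      · intro x y hx hy; have := hind x y hx hy; rw [a4, a3, a2, a1]; grind
      · have := d1 r; have := d2 r; have := d3 r; have := d4 r; grind
  push Not at c1
  -- degree bound in S
  have hdeg : ∀ k, r < k → (∀ i, i ≤ r → G.Adj k i) ∨ dg G k < r.val + 1 := by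
    intro k hk
    by_contra hc
    push Not at hc
    obtain ⟨⟨i, hi, hki⟩, h2⟩ := hc
    have hs : (Finset.univ.filter (fun w => G.Adj k w)) ⊆ (Finset.Iic r).erase i := by
      intro x hx
      simp only [Finset.mem_filter, Finset.mem_univ, true_and, Finset.mem_erase,
        Finset.mem_Iic] at hx ⊢
      exact ⟨by rintro rfl; exact hki hx, not_lt.1 fun h => hind k x hk h hx⟩
    have := Finset.card_le_card hs
    rw [Finset.card_erase_of_mem (by simpa using hi), Fin.card_Iic] at this
    unfold dg at h2
    omega
  have hdeg2 : ∀ k, r < k → dg G k ≤ r.val + 1 := by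
    intro k hk
    have hs : (Finset.univ.filter (fun w => G.Adj k w)) ⊆ (Finset.Iic r) := by
      intro x hx
      simp only [Finset.mem_filter, Finset.mem_univ, true_and, Finset.mem_Iic] at hx ⊢
      exact not_lt.1 fun h => hind k x hk h hx
    have := Finset.card_le_card hs
    rwa [Fin.card_Iic] at this
  have hfull : ∀ k, r < k → (∀ i, i ≤ r → G.Adj k i) → r.val + 1 ≤ dg G k := by
    intro k hk h
    have hs : (Finset.Iic r) ⊆ (Finset.univ.filter (fun w => G.Adj k w)) := by
      intro x hx
      simp only [Finset.mem_filter, Finset.mem_univ, true_and, Finset.mem_Iic] at hx ⊢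
      exact h x hx
    have := Finset.card_le_card hs
    rwa [Fin.card_Iic] at this
  -- case 2
  by_cases c2 : ∃ k, r < k ∧ dg G k ≠ min (r.val + 1) (d k)
  · obtain ⟨k, hk, hkm⟩ := c2
    have hk1 := hdeg2 k hk
    have hk2 := hle k
    have hkd : dg G k < d k := by omega
    have hkr : dg G k < r.val + 1 := by omega
    have hrk := c0 k hk hkd
    have : ∃ i, i ≤ r ∧ ¬ G.Adj k i := by
      by_contra hc
      push Not at hc
      have := hfull k hk hc
      omega
    obtain ⟨i, hi, hki⟩ := this
    have hir : i < r := lt_of_le_of_ne hi (by rintro rfl; exact hki hrk.symm)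
    obtain ⟨u, hu, hur, hru⟩ := exists_nbr G i r (hbig i hir)
    have hui : u ≠ i := hu.ne'
    have huk : u ≠ k := by rintro rfl; exact hki hu.symm
    have hki' : k ≠ i := (hir.trans hk).ne'
    obtain ⟨G1, a1, d1⟩ := dg_del G i u hu
    obtain ⟨G2, a2, d2⟩ := dg_add G1 r u hur.symm (by rw [a1]; tauto)
    obtain ⟨G3, a3, d3⟩ := dg_add G2 k i hki' (by rw [a2, a1]; grind)
    refine ⟨G3, ⟨?_, ?_, ?_⟩, ?_⟩
    · intro x; have := d1 x; have := d2 x; have := d3 x; have := hle x; grind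
    · intro x hx; have := d1 x; have := d2 x; have := d3 x; have := heq x hx; grind
    · intro x y hx hy; have := hind x y hx hy; rw [a3, a2, a1]; grind
    · have := d1 r; have := d2 r; have := d3 r; grind
  push Not at c2
  -- case 3
  by_cases c3 : ∃ i j, i < r ∧ j < r ∧ i ≠ j ∧ ¬ G.Adj i j
  · obtain ⟨i, j, hi, hj, hij, hnij⟩ := c3
    obtain ⟨u, hu, hur, hru⟩ := exists_nbr G i r (hbig i hi)
    obtain ⟨w, hw, hwr, hrw⟩ := exists_nbr G j r (hbig j hj)
    have hu' : r < u := lt_of_le_of_ne (not_lt.1 fun h => hru (c1 u h)) hur.symm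
    have hw' : r < w := lt_of_le_of_ne (not_lt.1 fun h => hrw (c1 w h)) hwr.symm
    obtain ⟨G1, a1, d1⟩ := dg_del G i u hu
    obtain ⟨G2, a2, d2⟩ := dg_del G1 j w (by rw [a1]; grind)
    obtain ⟨G3, a3, d3⟩ := dg_add G2 r u hur.symm (by rw [a2, a1]; tauto)
    obtain ⟨G4, a4, d4⟩ := dg_add G3 i j hij (by rw [a3, a2, a1]; grind)
    refine ⟨G4, ⟨?_, ?_, ?_⟩, ?_⟩
    · intro x; have := d1 x; have := d2 x; have := d3 x; have := d4 x; have := hle x; grind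
    · intro x hx; have := d1 x; have := d2 x; have := d3 x; have := d4 x; have := heq x hx; grind
    · intro x y hx hy; have := hind x y hx hy; rw [a4, a3, a2, a1]; grind
    · have := d1 r; have := d2 r; have := d3 r; have := d4 r; grind
  push Not at c3
  exfalso
  have hcl : ∀ i j, i ≤ r → j ≤ r → i ≠ j → G.Adj i j := by
    intro i j hi hj hij
    rcases hi.lt_or_eq with hi | rfl
    · rcases hj.lt_or_eq with hj | rfl
      · exact c3 i j hi hj hij
      · exact (c1 i hi).symm
    · rcases hj.lt_or_eq with hj | rfl
      · exact c1 j hj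
      · exact absurd rfl hij
  have hfc := final_count d r G hcl hind c2
  have : ∑ i with i ≤ r, dg G i < ∑ i with i ≤ r, d i :=
    Finset.sum_lt_sum (fun i _ => hle i) ⟨r, by simp, hr⟩
  omega

theorem step {n : ℕ} (d : Fin n → ℕ) (hd : Antitone d) (he : Even (∑ i, d i))
    (r : Fin n)
    (hEG : ∑ i with i ≤ r, d i ≤ (r.val + 1) * r.val + ∑ i with r < i, min (r.val + 1) (d i)) :
    ∀ m (G : SimpleGraph (Fin n)), d r - dg G r ≤ m → SubReal d r G →
      ∃ G', SubReal d r G' ∧ dg G' r = d r := by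
  intro m
  induction m with
  | zero =>
    intro G hm hG
    exact ⟨G, hG, le_antisymm (hG.1 r) (by omega)⟩
  | succ m ih =>
    intro G hm hG
    by_cases h : dg G r < d r
    · obtain ⟨G', h1, h2⟩ := improve d hd he r hEG G hG h
      exact ih G' (by omega) h1
    · exact ⟨G, hG, le_antisymm (hG.1 r) (by omega)⟩

open Classical in
theorem erdos_gallai {n : ℕ} (d : Fin n → ℕ) (hd : Antitone d) (he : Even (∑ i, d i))
    (hEG : ∀ r : Fin n, ∑ i with i ≤ r, d i ≤
      (r.val + 1) * r.val + ∑ i with r < i, min (r.val + 1) (d i)) : IsGraphic d := by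
  have key : ∀ m, m ≤ n → ∃ G : SimpleGraph (Fin n), (∀ i, dg G i ≤ d i) ∧
      (∀ i, i.val < m → dg G i = d i) ∧
      (∀ i j, m ≤ i.val → m ≤ j.val → ¬ G.Adj i j) := by
    intro m
    induction m with
    | zero =>
      intro _
      exact ⟨⊥, by simp [dg], by simp, by simp⟩
    | succ m ih =>
      intro hm
      obtain ⟨G, h1, h2, h3⟩ := ih (by omega)
      let r : Fin n := ⟨m, hm⟩
      have hG : SubReal d r G := ⟨h1, fun i hi => h2 i hi,
        fun i j hi hj => h3 i j (le_of_lt hi) (le_of_lt hj)⟩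
      obtain ⟨G', ⟨g1, g2, g3⟩, g4⟩ := step d hd he r (hEG r) _ G le_rfl hG
      refine ⟨G', g1, ?_, fun i j hi hj => g3 i j hi hj⟩
      intro i hi
      rcases Nat.lt_succ_iff_lt_or_eq.1 hi with h | h
      · exact g2 i h
      · have : i = r := Fin.ext h
        rw [this, g4]
  obtain ⟨G, -, h2, -⟩ := key n le_rfl
  refine ⟨G, inferInstance, fun i => ?_⟩
  rw [← h2 i i.2, ← SimpleGraph.card_neighborFinset_eq_degree,
    SimpleGraph.neighborFinset_eq_filter]
  rfl

theorem arith (n a b k y : ℚ) (hb : 0 ≤ b) (han : a + 1 ≤ n) (hbk : b + 1 ≤ k) (hka : k ≤ a)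
    (hQ : 0 ≤ y ^ 2 - (a + b + 1) * y + n * b) (S T M s : ℚ)
    (hs : s = n * b + (a - b) * y) (hST : S + T = s) (hS : S ≤ k * a) (hT : (n - k) * b ≤ T)
    (hM : (a - b) * ((n - k) * b) + (T - (n - k) * b) * (k - b) ≤ (a - b) * M) :
    S ≤ k * (k - 1) + M := by
  have hd : 0 < a - b := by linarith
  have hT' : T = s - S := by linarith
  subst hT' hs
  suffices h : (a - b) * S ≤ (a - b) * (k * (k - 1) + M) from le_of_mul_le_mul_left h hd
  have hj : 0 < a - b + (k - b) := by linarith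
  suffices h : S * (a - b + (k - b)) ≤ (a - b) * (k * (k - 1)) + (n - k) * b * ((a - b) - (k - b))
      + (k - b) * (n * b + (a - b) * y) by nlinarith
  rcases le_total k y with hy | hy
  · have h1 : 0 ≤ (k ^ 2 - (a + b + 1) * k + n * b) + (k - b) * (y - k) := by
      rcases le_total y (a + 1) with h | h
      · nlinarith [mul_nonneg (sub_nonneg.2 hy) (sub_nonneg.2 h)]
      · have e1 : 0 ≤ (k - b) * (y - (a + 1)) := mul_nonneg (by linarith) (by linarith)
        have e2 : 0 ≤ b * (n - (a + 1)) := mul_nonneg hb (by linarith)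
        nlinarith
    have h2 := mul_nonneg hd.le h1
    have h3 := mul_le_mul_of_nonneg_right hS hj.le
    nlinarith
  · have h1 : 0 ≤ (k ^ 2 - (a + b + 1) * k + n * b) + (a - b) * (k - y) := by
      rcases le_total b y with h | h
      · have : 0 ≤ (k - y) * (y + k - 2 * b - 1) := mul_nonneg (by linarith) (by linarith)
        nlinarith
      · have e1 : 0 ≤ (a - b) * (b - y) := mul_nonneg (by linarith) (by linarith)
        have e2 : 0 ≤ b * (n - (a + 1)) := mul_nonneg hb (by linarith)
        have e3 : 0 ≤ (k - b) * (k - b - 1) := mul_nonneg (by linarith) (by linarith)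
        nlinarith
    have h2 := mul_nonneg hd.le h1
    have hS' : S ≤ (a - b) * y + k * b := by linarith
    have h3 := mul_le_mul_of_nonneg_right hS' hj.le
    nlinarith

theorem stmt_0 {n : ℕ} (hn : 0 < n) (α : Fin n → ℕ) (hα : Antitone α)
    (a1 : ℕ) (an : ℕ) (ha1 : a1 = α ⟨0, hn⟩) (han : an = α ⟨n - 1, by omega⟩)
    (s : ℕ) (hs : s = ∑ i, α i) (hcap : a1 + 1 ≤ n) (heven : Even s)
    (hub : s < n * a1) (hlb : n * an < s)
    (hineq : ((a1 : ℚ) - an) *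
      (((n : ℚ) - a1 - 1) / ((n : ℚ) * a1 - s) + (an : ℚ) / ((s : ℚ) - n * an)) ≥ 1) :
    IsGraphic α := by
  have hup : ∀ i, α i ≤ a1 := fun i => ha1 ▸ hα (Fin.mk_le_of_le_val (Nat.zero_le _))
  have hlo : ∀ i, an ≤ α i := fun i => han ▸ hα (Fin.le_def.2 (by have := i.2; simp; omega))
  refine erdos_gallai α hα (hs ▸ heven) fun r => ?_
  have hcard : (Finset.univ.filter (fun i : Fin n => i ≤ r)).card = r.val + 1 := by
    have : (Finset.univ.filter (fun i : Fin n => i ≤ r)) = Finset.Iic r := by ext; simp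
    rw [this, Fin.card_Iic]
  have hcard2 : (Finset.univ.filter (fun i : Fin n => r < i)).card = n - (r.val + 1) := by
    have : (Finset.univ.filter (fun i : Fin n => r < i)) = Finset.Ioi r := by ext; simp
    rw [this, Fin.card_Ioi]; omega
  have hrn : r.val + 1 ≤ n := r.2
  have hS : ∑ i with i ≤ r, α i ≤ (r.val + 1) * a1 := by
    have := Finset.sum_le_card_nsmul (Finset.univ.filter (fun i : Fin n => i ≤ r)) α a1
      (fun i _ => hup i)
    rwa [hcard, smul_eq_mul] at this
  by_cases c1 : a1 ≤ r.val
  · have := Nat.mul_le_mul_left (r.val + 1) c1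
    omega
  by_cases c2 : r.val + 1 ≤ an
  · have : ∑ i with r < i, min (r.val + 1) (α i) = (n - (r.val + 1)) * (r.val + 1) := by
      rw [Finset.sum_congr rfl (fun i _ => min_eq_left (c2.trans (hlo i))), Finset.sum_const,
        hcard2, smul_eq_mul]
    rw [this]
    refine hS.trans ?_
    obtain ⟨m, hm⟩ := Nat.exists_eq_add_of_le hrn
    have hm' : n - (r.val + 1) = m := by omega
    rw [hm']
    have : a1 ≤ r.val + m := by omega
    nlinarith
  have hST : ∑ i with i ≤ r, α i + ∑ i with r < i, α i = s := by
    rw [hs, ← Finset.sum_filter_add_sum_filter_not Finset.univ (fun i => i ≤ r)]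
    simp only [not_le]
  have hd : (0 : ℚ) < a1 - an := by
    have : an < a1 := by omega
    have : (an : ℚ) < a1 := by exact_mod_cast this
    linarith
  have hX : (0 : ℚ) < n * a1 - s := by
    have : (s : ℚ) < n * a1 := by exact_mod_cast hub
    linarith
  have hY : (0 : ℚ) < s - n * an := by
    have : (n * an : ℚ) < s := by exact_mod_cast hlb
    linarith
  have hQ : (0 : ℚ) ≤ (((s : ℚ) - n * an) / (a1 - an)) ^ 2 -
      (a1 + an + 1) * (((s : ℚ) - n * an) / (a1 - an)) + n * an := by
    have h1 : ((n : ℚ) * a1 - s) * (s - n * an) ≤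
        (a1 - an) * ((n - a1 - 1) * (s - n * an) + an * (n * a1 - s)) := by
      rw [div_add_div _ _ hX.ne' hY.ne', ← mul_div_assoc, ge_iff_le,
        le_div_iff₀ (mul_pos hX hY)] at hineq
      linarith
    set y := ((s : ℚ) - n * an) / (a1 - an) with hy
    have hy' : (s : ℚ) = n * an + (a1 - an) * y := by
      rw [hy]; field_simp; ring
    rw [hy'] at h1
    have : 0 ≤ ((a1 : ℚ) - an) ^ 2 * (y ^ 2 - (a1 + an + 1) * y + n * an) := by
      linarith
    exact nonneg_of_mul_nonneg_right this (by positivity)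
  have hTM : ((n : ℚ) - (r.val + 1)) = ∑ i : Fin n with r < i, (1 : ℚ) := by
    rw [Finset.sum_const, hcard2]; push_cast [hrn]; simp
  have hc1 : ((r.val : ℚ) + 1) ≤ a1 := by
    have : r.val + 1 ≤ a1 := by omega
    exact_mod_cast this
  have hc2 : (an : ℚ) + 1 ≤ r.val + 1 := by
    have : an + 1 ≤ r.val + 1 := by omega
    exact_mod_cast this
  have hup' : ∀ i, (α i : ℚ) ≤ a1 := fun i => by exact_mod_cast hup i
  have hlo' : ∀ i, (an : ℚ) ≤ α i := fun i => by exact_mod_cast hlo i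
  have fin := arith n a1 an (r.val + 1) (((s : ℚ) - n * an) / (a1 - an)) (by positivity)
    (by exact_mod_cast hcap) hc2 hc1 hQ
    ((∑ i with i ≤ r, α i : ℕ) : ℚ) ((∑ i with r < i, α i : ℕ) : ℚ)
    ((∑ i with r < i, min (r.val + 1) (α i) : ℕ) : ℚ) s
    (by field_simp; ring) (by exact_mod_cast hST) (by exact_mod_cast hS)
    (by
      rw [hTM, Finset.sum_mul]; push_cast
      exact Finset.sum_le_sum fun i _ => by rw [one_mul]; exact hlo' i)
    (by
      rw [hTM, Finset.sum_mul]; push_cast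
      rw [← Finset.sum_sub_distrib, Finset.mul_sum, Finset.mul_sum, Finset.sum_mul,
        ← Finset.sum_add_distrib]
      refine Finset.sum_le_sum fun i _ => ?_
      have := hup' i
      have := hlo' i
      rcases min_cases ((r.val : ℚ) + 1) (α i : ℚ) with ⟨h, h'⟩ | ⟨h, h'⟩
      · rw [h]; nlinarith
      · rw [h]; nlinarith)
  rw [add_sub_cancel_right] at fin
  exact_mod_cast fin
end

section
/- A nonincreasing sequence α = (α₁, ..., αₙ) of nonnegative integers with even sum is graphic if and only if for every index k with α_k > α_{k+1} (taking α_{n+1} = -1 or just k such that α strictly decreases after k, including k = n), the Erdős–Gallai inequality ∑_{i=1}^k αᵢ ≤ k(k-1) + ∑_{i=k+1}^n min(k, αᵢ) holds. -/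
/-- The Erdős–Gallai inequality at index `k` (1-indexed) for a sequence on `Fin n`. -/
def ErdosGallaiIneq {n : ℕ} (α : Fin n → ℕ) (k : ℕ) : Prop :=
  ∑ i ∈ Finset.univ.filter (fun i : Fin n => (i : ℕ) < k), α i ≤
    k * (k - 1) + ∑ i ∈ Finset.univ.filter (fun i : Fin n => k ≤ (i : ℕ)), min k (α i)

open Classical in
noncomputable def tvDeg {n : ℕ} (G : SimpleGraph (Fin n)) (x : Fin n) : ℕ :=
  ∑ y, if G.Adj x y then 1 else 0

lemma tvDeg_eq {n : ℕ} (G : SimpleGraph (Fin n)) [DecidableRel G.Adj] (x : Fin n) :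
    tvDeg G x = G.degree x := by
  classical
  unfold tvDeg
  rw [← SimpleGraph.card_neighborFinset_eq_degree, SimpleGraph.neighborFinset_eq_filter,
    Finset.card_filter]
  refine Finset.sum_congr rfl fun y _ => ?_
  congr

lemma tvDeg_even {n : ℕ} (G : SimpleGraph (Fin n)) : Even (∑ x, tvDeg G x) := by
  classical
  simp only [tvDeg_eq]
  rw [SimpleGraph.sum_degrees_eq_twice_card_edges]
  exact even_two_mul _

def tvAdd {n : ℕ} (G : SimpleGraph (Fin n)) (u v : Fin n) (h : u ≠ v) : SimpleGraph (Fin n) where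
  Adj x y := G.Adj x y ∨ (x = u ∧ y = v) ∨ (x = v ∧ y = u)
  symm := ⟨by intro x y hh; rcases hh with hh | hh | hh
              · exact Or.inl hh.symm
              · tauto
              · tauto⟩
  loopless := ⟨by intro x hh; rcases hh with hh | hh | hh
                  · exact G.loopless.irrefl x hh
                  · exact h (hh.1.symm.trans hh.2)
                  · exact h (hh.2.symm.trans hh.1)⟩

def tvDel {n : ℕ} (G : SimpleGraph (Fin n)) (u v : Fin n) : SimpleGraph (Fin n) where
  Adj x y := G.Adj x y ∧ ¬ ((x = u ∧ y = v) ∨ (x = v ∧ y = u))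
  symm := ⟨by intro x y hh; exact ⟨hh.1.symm, by tauto⟩⟩
  loopless := ⟨by intro x hh; exact G.loopless.irrefl x hh.1⟩

lemma tvAdd_adj {n : ℕ} (G : SimpleGraph (Fin n)) (u v : Fin n) (h : u ≠ v) (x y : Fin n) :
    (tvAdd G u v h).Adj x y ↔ (G.Adj x y ∨ (x = u ∧ y = v) ∨ (x = v ∧ y = u)) := Iff.rfl

lemma tvDel_adj {n : ℕ} (G : SimpleGraph (Fin n)) (u v : Fin n) (x y : Fin n) :
    (tvDel G u v).Adj x y ↔ (G.Adj x y ∧ ¬ ((x = u ∧ y = v) ∨ (x = v ∧ y = u))) := Iff.rfl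

lemma tvDeg_add {n : ℕ} (G : SimpleGraph (Fin n)) (u v : Fin n) (h : u ≠ v) (hn : ¬ G.Adj u v)
    (x : Fin n) : tvDeg (tvAdd G u v h) x =
      tvDeg G x + (if x = u then 1 else 0) + (if x = v then 1 else 0) := by
  classical
  have hn' : ¬ G.Adj v u := fun hh => hn hh.symm
  have e1 : (if x = u then 1 else 0) = ∑ y : Fin n, if y = v then (if x = u then 1 else 0) else 0 := by
    simp
  have e2 : (if x = v then 1 else 0) = ∑ y : Fin n, if y = u then (if x = v then 1 else 0) else 0 := by
    simp
  rw [e1, e2]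
  unfold tvDeg
  rw [← Finset.sum_add_distrib, ← Finset.sum_add_distrib]
  refine Finset.sum_congr rfl fun y _ => ?_
  simp only [tvAdd_adj]
  grind

lemma tvDeg_del {n : ℕ} (G : SimpleGraph (Fin n)) (u v : Fin n) (hn : G.Adj u v)
    (x : Fin n) : tvDeg (tvDel G u v) x + (if x = u then 1 else 0) + (if x = v then 1 else 0) =
      tvDeg G x := by
  classical
  have hn' : G.Adj v u := hn.symm
  have h : u ≠ v := hn.ne
  have e1 : (if x = u then 1 else 0) = ∑ y : Fin n, if y = v then (if x = u then 1 else 0) else 0 := by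
    simp
  have e2 : (if x = v then 1 else 0) = ∑ y : Fin n, if y = u then (if x = v then 1 else 0) else 0 := by
    simp
  rw [e1, e2]
  unfold tvDeg
  rw [← Finset.sum_add_distrib, ← Finset.sum_add_distrib]
  refine Finset.sum_congr rfl fun y _ => ?_
  simp only [tvDel_adj]
  grind

lemma tv_exists {n : ℕ} (G : SimpleGraph (Fin n)) (r i : Fin n) (h : tvDeg G r < tvDeg G i) :
    ∃ u, G.Adj i u ∧ ¬ G.Adj r u ∧ u ≠ r := by
  classical
  by_contra hc
  push Not at hc
  have hir : i ≠ r := by rintro rfl; omega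
  have : tvDeg G i ≤ tvDeg G r := by
    rw [tvDeg_eq, tvDeg_eq, ← SimpleGraph.card_neighborFinset_eq_degree,
      ← SimpleGraph.card_neighborFinset_eq_degree]
    apply Finset.card_le_card_of_injOn (fun u => if u = r then i else u)
    · intro u hu
      have hu' : G.Adj i u := by simpa using hu
      have := hc u hu'
      simp only [Finset.mem_coe, SimpleGraph.mem_neighborFinset]
      split_ifs with h1
      · subst h1; exact hu'.symm
      · by_contra h2; exact h1 (this h2)
    · intro u hu v hv huv
      have hu' : G.Adj i u := by simpa using hu
      have hv' : G.Adj i v := by simpa using hv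
      have := hu'.ne
      have := hv'.ne
      grind
  omega

open Classical in
lemma tv_split {n : ℕ} (G : SimpleGraph (Fin n)) (k : ℕ) :
    ∑ i ∈ Finset.univ.filter (fun i : Fin n => (i : ℕ) < k), tvDeg G i =
      (∑ i ∈ Finset.univ.filter (fun i : Fin n => (i : ℕ) < k),
        ∑ j ∈ Finset.univ.filter (fun i : Fin n => (i : ℕ) < k), if G.Adj i j then 1 else 0) +
      ∑ j ∈ Finset.univ.filter (fun i : Fin n => k ≤ (i : ℕ)),
        ∑ i ∈ Finset.univ.filter (fun i : Fin n => (i : ℕ) < k), if G.Adj j i then 1 else 0 := by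
  rw [Finset.sum_comm (s := Finset.univ.filter (fun i : Fin n => k ≤ (i : ℕ))),
    ← Finset.sum_add_distrib]
  refine Finset.sum_congr rfl fun i _ => ?_
  unfold tvDeg
  rw [← Finset.sum_filter_add_sum_filter_not Finset.univ (fun i : Fin n => (i : ℕ) < k)]
  simp only [not_lt, G.adj_comm i]

lemma tv_card {n : ℕ} (k : ℕ) (hk : k ≤ n) :
    (Finset.univ.filter (fun i : Fin n => (i : ℕ) < k)).card = k := by
  rw [Fin.card_filter_val_lt]; omega

open Classical in
lemma tv_clique {n : ℕ} (k : ℕ) (hk : k ≤ n) :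
    (∑ i ∈ Finset.univ.filter (fun i : Fin n => (i : ℕ) < k),
        ∑ j ∈ Finset.univ.filter (fun i : Fin n => (i : ℕ) < k), if i ≠ j then 1 else 0)
      = k * (k - 1) := by
  have : ∀ i ∈ Finset.univ.filter (fun i : Fin n => (i : ℕ) < k),
      (∑ j ∈ Finset.univ.filter (fun i : Fin n => (i : ℕ) < k), if i ≠ j then 1 else 0) = k - 1 := by
    intro i hi
    rw [← Finset.card_filter, Finset.filter_ne, Finset.card_erase_of_mem hi, tv_card k hk]
  rw [Finset.sum_congr rfl this, Finset.sum_const, tv_card k hk, smul_eq_mul]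

lemma tv_necessary {n : ℕ} (G : SimpleGraph (Fin n)) (k : ℕ) (hk : k ≤ n) :
    ErdosGallaiIneq (tvDeg G) k := by
  classical
  unfold ErdosGallaiIneq
  rw [tv_split, ← tv_clique k hk]
  apply add_le_add
  · refine Finset.sum_le_sum fun i _ => Finset.sum_le_sum fun j _ => ?_
    have := @SimpleGraph.Adj.ne _ G i j
    split_ifs <;> simp_all
  · refine Finset.sum_le_sum fun j _ => le_min ?_ ?_
    · rw [← Finset.card_filter]
      exact (Finset.card_filter_le _ _).trans (tv_card k hk).le
    · exact Finset.sum_le_sum_of_subset (Finset.filter_subset _ _)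

def tvInv {n : ℕ} (d : Fin n → ℕ) (r : ℕ) (G : SimpleGraph (Fin n)) : Prop :=
  (∀ i : Fin n, (i : ℕ) < r → tvDeg G i = d i) ∧ (∀ i, tvDeg G i ≤ d i) ∧
    ∀ i j : Fin n, r < (i : ℕ) → r < (j : ℕ) → ¬ G.Adj i j

lemma tv_step {n : ℕ} (d : Fin n → ℕ) (hd : Antitone d) (hev : Even (∑ i, d i))
    (r : Fin n) (hEG : ErdosGallaiIneq d (r + 1)) (G : SimpleGraph (Fin n)) (hG : tvInv d r G)
    (hlt : tvDeg G r < d r) : ∃ G', tvInv d r G' ∧ tvDeg G r < tvDeg G' r := by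
  classical
  obtain ⟨hA, hB, hC⟩ := hG
  have hirr : ∀ x, ¬ G.Adj x x := fun x => G.loopless.irrefl x
  have hsymm : ∀ x y, G.Adj x y → G.Adj y x := fun x y h => h.symm
  have hne : ∀ i : Fin n, (i : ℕ) < r → i ≠ r := by rintro i hi rfl; omega
  have hne' : ∀ i : Fin n, (r : ℕ) < i → i ≠ r := by rintro i hi rfl; omega
  have htri : ∀ i : Fin n, i ≠ r → (i : ℕ) < r ∨ (r : ℕ) < i := by
    intro i hi
    have : (i : ℕ) ≠ r := fun h => hi (Fin.ext h)
    omega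
  have hU : ∀ i : Fin n, (i : ℕ) < r → ∃ u, G.Adj i u ∧ ¬ G.Adj r u ∧ u ≠ r := by
    intro i hi
    apply tv_exists
    rw [hA i hi]
    exact hlt.trans_le (hd (Fin.le_def.2 hi.le))
  -- Case 0
  by_cases h0 : ∃ k, k ≠ r ∧ tvDeg G k < d k ∧ ¬ G.Adj r k
  · obtain ⟨k, hkr, hk, hadj⟩ := h0
    have D := tvDeg_add G r k hkr.symm hadj
    refine ⟨tvAdd G r k hkr.symm, ⟨?_, ?_, ?_⟩, ?_⟩
    rotate_right
    · rw [D]; simp only [if_true]; omega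
    · intro i hi
      rw [D]
      have := hne i hi
      have := hA i hi
      grind
    · intro i
      rw [D]
      have := hB i
      grind
    · intro i j hi hj
      rw [tvAdd_adj]
      have := hC i j hi hj
      have := hne' i hi
      have := hne' j hj
      grind
  push Not at h0
  -- Case 1
  by_cases h1 : ∃ i : Fin n, (i : ℕ) < r ∧ ¬ G.Adj r i
  · obtain ⟨i, hi, hri⟩ := h1
    obtain ⟨u, hiu, hru, hur⟩ := hU i hi
    have hir := hne i hi
    have hiu' := hiu.ne
    have D1 := tvDeg_del G i u hiu
    have D2 := tvDeg_add (tvDel G i u) u r hur (by rw [tvDel_adj]; grind)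
    have D3 := tvDeg_add (tvAdd (tvDel G i u) u r hur) i r hir
      (by rw [tvAdd_adj, tvDel_adj]; grind)
    by_cases h2 : tvDeg G r + 2 ≤ d r
    · refine ⟨tvAdd (tvAdd (tvDel G i u) u r hur) i r hir, ⟨?_, ?_, ?_⟩, ?_⟩
      rotate_right
      · rw [D3, D2]
        have := D1 r
        grind
      · intro x hx
        rw [D3, D2]
        have := D1 x
        have := hne x hx
        have := hA x hx
        grind
      · intro x
        rw [D3, D2]
        have := D1 x
        have := hB x
        grind
      · intro x y hx hy
        rw [tvAdd_adj, tvAdd_adj, tvDel_adj]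
        have := hC x y hx hy
        have := hne' x hx
        have := hne' y hy
        grind
    · have hk : ∃ k, k ≠ r ∧ tvDeg G k < d k := by
        by_contra hc
        push Not at hc
        have e1 : ∑ x, d x = ∑ x, (tvDeg G x + if x = r then 1 else 0) := by
          refine Finset.sum_congr rfl fun x _ => ?_
          have := hc x
          have := hB x
          split_ifs with hx
          · subst hx; omega
          · have := hc x hx; omega
        rw [Finset.sum_add_distrib] at e1
        have e2 := tvDeg_even G
        simp at e1
        rw [e1] at hev
        grind
      obtain ⟨k, hkr, hk⟩ := hk
      have hrk := h0 k hkr hk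
      have hkgt : (r : ℕ) < k := by
        rcases htri k hkr with h | h
        · have := hA k h; omega
        · exact h
      have hku : k ≠ u := by rintro rfl; exact hru hrk
      have hki : k ≠ i := by rintro rfl; exact hri hrk
      have D4 := tvDeg_del (tvAdd (tvAdd (tvDel G i u) u r hur) i r hir) r k
        (by rw [tvAdd_adj, tvAdd_adj, tvDel_adj]; grind)
      refine ⟨tvDel (tvAdd (tvAdd (tvDel G i u) u r hur) i r hir) r k, ⟨?_, ?_, ?_⟩, ?_⟩
      rotate_right
      · have := D1 r
        have := D4 r
        rw [D3, D2] at this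
        grind
      · intro x hx
        have := D1 x
        have := hne x hx
        have := hA x hx
        have : x ≠ k := by rintro rfl; omega
        have := D4 x
        rw [D3, D2] at this
        grind
      · intro x
        have := D1 x
        have := hB x
        have := D4 x
        rw [D3, D2] at this
        grind
      · intro x y hx hy
        rw [tvDel_adj, tvAdd_adj, tvAdd_adj, tvDel_adj]
        have := hC x y hx hy
        have := hne' x hx
        have := hne' y hy
        grind
  push Not at h1
  -- Case 2
  by_cases h2 : ∃ k : Fin n, (r : ℕ) < k ∧ tvDeg G k < min ((r : ℕ) + 1) (d k)
  · obtain ⟨k, hrk, hk⟩ := h2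
    have hkr := hne' k hrk
    have hrk' := h0 k hkr (by omega)
    have hi : ∃ i : Fin n, (i : ℕ) < r ∧ ¬ G.Adj k i := by
      by_contra hc
      push Not at hc
      have : (r : ℕ) + 1 ≤ tvDeg G k := by
        rw [tvDeg, ← Finset.card_filter, ← tv_card (n := n) (r + 1) r.2]
        apply Finset.card_le_card
        intro x hx
        simp only [Finset.mem_filter, Finset.mem_univ, true_and] at hx ⊢
        by_cases hxr : x = r
        · subst hxr; exact hrk'.symm
        · apply hc
          rcases htri x hxr with h | h <;> omega
      omega
    obtain ⟨i, hi, hki⟩ := hi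
    obtain ⟨u, hiu, hru, hur⟩ := hU i hi
    have hir := hne i hi
    have hiu' := hiu.ne
    have hik : i ≠ k := by rintro rfl; omega
    have huk : u ≠ k := by rintro rfl; exact hru hrk'
    have D1 := tvDeg_del G i u hiu
    have D2 := tvDeg_add (tvDel G i u) u r hur (by rw [tvDel_adj]; grind)
    have D3 := tvDeg_add (tvAdd (tvDel G i u) u r hur) i k hik
      (by rw [tvAdd_adj, tvDel_adj]; grind)
    refine ⟨tvAdd (tvAdd (tvDel G i u) u r hur) i k hik, ⟨?_, ?_, ?_⟩, ?_⟩
    rotate_right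
    · rw [D3, D2]
      have := D1 r
      grind
    · intro x hx
      rw [D3, D2]
      have := D1 x
      have := hne x hx
      have := hA x hx
      have : x ≠ k := by rintro rfl; omega
      grind
    · intro x
      rw [D3, D2]
      have := D1 x
      have := hB x
      grind
    · intro x y hx hy
      rw [tvAdd_adj, tvAdd_adj, tvDel_adj]
      have := hC x y hx hy
      have := hne' x hx
      have := hne' y hy
      have : x ≠ i := by rintro rfl; omega
      have : y ≠ i := by rintro rfl; omega
      grind
  push Not at h2
  -- Case 3
  by_cases h3 : ∃ i j : Fin n, (i : ℕ) < r ∧ (j : ℕ) < r ∧ i ≠ j ∧ ¬ G.Adj i j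
  · obtain ⟨i, j, hi, hj, hij, hadj⟩ := h3
    obtain ⟨u, hiu, hru, hur⟩ := hU i hi
    obtain ⟨w, hjw, hrw, hwr⟩ := hU j hj
    have hir := hne i hi
    have hjr := hne j hj
    have hiu' := hiu.ne
    have hjw' := hjw.ne
    have hugt : (r : ℕ) < u := by
      rcases htri u hur with h | h
      · exact absurd (h1 u h) hru
      · exact h
    have hwgt : (r : ℕ) < w := by
      rcases htri w hwr with h | h
      · exact absurd (h1 w h) hrw
      · exact h
    have hiw : i ≠ w := by rintro rfl; omega
    have hju : j ≠ u := by rintro rfl; omega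
    have D1 := tvDeg_del G i u hiu
    have D2 := tvDeg_del (tvDel G i u) j w (by rw [tvDel_adj]; grind)
    have D3 := tvDeg_add (tvDel (tvDel G i u) j w) u r hur
      (by rw [tvDel_adj, tvDel_adj]; grind)
    have D4 := tvDeg_add (tvAdd (tvDel (tvDel G i u) j w) u r hur) i j hij
      (by rw [tvAdd_adj, tvDel_adj, tvDel_adj]; grind)
    refine ⟨tvAdd (tvAdd (tvDel (tvDel G i u) j w) u r hur) i j hij, ⟨?_, ?_, ?_⟩, ?_⟩
    rotate_right
    · rw [D4, D3]
      have := D1 r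
      have := D2 r
      grind
    · intro x hx
      rw [D4, D3]
      have := D1 x
      have := D2 x
      have := hne x hx
      have := hA x hx
      have : x ≠ u := by rintro rfl; omega
      have : x ≠ w := by rintro rfl; omega
      grind
    · intro x
      rw [D4, D3]
      have := D1 x
      have := D2 x
      have := hB x
      grind
    · intro x y hx hy
      rw [tvAdd_adj, tvAdd_adj, tvDel_adj, tvDel_adj]
      have := hC x y hx hy
      have := hne' x hx
      have := hne' y hy
      have : x ≠ i := by rintro rfl; omega
      have : y ≠ i := by rintro rfl; omega
      grind
  push Not at h3
  -- final contradiction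
  exfalso
  have hs := tv_split G (r + 1)
  have hcl : (∑ i ∈ Finset.univ.filter (fun i : Fin n => (i : ℕ) < r + 1),
        ∑ j ∈ Finset.univ.filter (fun i : Fin n => (i : ℕ) < r + 1), if G.Adj i j then 1 else 0)
      = ((r : ℕ) + 1) * ((r : ℕ) + 1 - 1) := by
    rw [← tv_clique (n := n) (r + 1) r.2]
    refine Finset.sum_congr rfl fun i hi => Finset.sum_congr rfl fun j hj => ?_
    simp only [Finset.mem_filter, Finset.mem_univ, true_and] at hi hj
    have : G.Adj i j ↔ i ≠ j := by
      refine ⟨fun h => h.ne, fun h => ?_⟩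
      by_cases hir : i = r
      · subst hir
        apply h1
        rcases htri j h.symm with h | h <;> omega
      · by_cases hjr : j = r
        · subst hjr
          apply hsymm
          apply h1
          rcases htri i h with h | h <;> omega
        · apply h3 i j _ _ h
          · rcases htri i hir with h | h <;> omega
          · rcases htri j hjr with h | h <;> omega
    simp only [this]
  have hout : ∑ i ∈ Finset.univ.filter (fun i : Fin n => (r : ℕ) + 1 ≤ (i : ℕ)), min ((r : ℕ) + 1) (d i)
      ≤ ∑ j ∈ Finset.univ.filter (fun i : Fin n => (r : ℕ) + 1 ≤ (i : ℕ)),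
        ∑ i ∈ Finset.univ.filter (fun i : Fin n => (i : ℕ) < r + 1), if G.Adj j i then 1 else 0 := by
    refine Finset.sum_le_sum fun j hj => ?_
    simp only [Finset.mem_filter, Finset.mem_univ, true_and] at hj
    refine (h2 j hj).trans (le_of_eq ?_)
    unfold tvDeg
    symm
    apply Finset.sum_subset (Finset.filter_subset _ _)
    intro x _ hx
    simp only [Finset.mem_filter, Finset.mem_univ, true_and] at hx
    rw [if_neg]
    exact hC j x hj (by omega)
  have hlt' : ∑ i ∈ Finset.univ.filter (fun i : Fin n => (i : ℕ) < r + 1), tvDeg G i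
      < ∑ i ∈ Finset.univ.filter (fun i : Fin n => (i : ℕ) < r + 1), d i := by
    apply Finset.sum_lt_sum
    · intro i _; exact hB i
    · exact ⟨r, by simp, hlt⟩
  unfold ErdosGallaiIneq at hEG
  rw [hcl] at hs
  omega

lemma tv_fill {n : ℕ} (d : Fin n → ℕ) (hd : Antitone d) (hev : Even (∑ i, d i))
    (r : Fin n) (hEG : ErdosGallaiIneq d (r + 1)) (m : ℕ) :
    ∀ G : SimpleGraph (Fin n), tvInv d r G → d r - tvDeg G r ≤ m →
      ∃ G', tvInv d r G' ∧ tvDeg G' r = d r := by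
  induction m with
  | zero =>
    intro G hG h
    have := hG.2.1 r
    exact ⟨G, hG, by omega⟩
  | succ m ih =>
    intro G hG h
    by_cases hlt : tvDeg G r < d r
    · obtain ⟨G', hG', h'⟩ := tv_step d hd hev r hEG G hG hlt
      exact ih G' hG' (by omega)
    · have := hG.2.1 r
      exact ⟨G, hG, by omega⟩

lemma tv_sufficient {n : ℕ} (d : Fin n → ℕ) (hd : Antitone d) (hev : Even (∑ i, d i))
    (hEG : ∀ k, 1 ≤ k → k ≤ n → ErdosGallaiIneq d k) :
    ∃ G : SimpleGraph (Fin n), ∀ i, tvDeg G i = d i := by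
  have key : ∀ r : ℕ, r ≤ n → ∃ G, tvInv d r G := by
    intro r
    induction r with
    | zero =>
      intro _
      refine ⟨⊥, ?_, ?_, ?_⟩
      · intro i hi; omega
      · intro i; simp [tvDeg]
      · intro i j _ _; simp
    | succ r ih =>
      intro hr
      obtain ⟨G, hG⟩ := ih (by omega)
      obtain ⟨G', hG', h⟩ := tv_fill d hd hev ⟨r, hr⟩ (hEG (r + 1) (by omega) hr) _ G hG le_rfl
      refine ⟨G', ?_, hG'.2.1, ?_⟩
      · intro i hi
        by_cases hir : (i : ℕ) = r
        · have : i = ⟨r, hr⟩ := Fin.ext hir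
          rw [this, h]
        · exact hG'.1 i (by simp; omega)
      · intro i j hi hj
        exact hG'.2.2 i j (by simp; omega) (by simp; omega)
  obtain ⟨G, hG⟩ := key n le_rfl
  exact ⟨G, fun i => hG.1 i i.2⟩

def tvF {n : ℕ} (α : Fin n → ℕ) (k : ℕ) : ℤ :=
  (∑ i : Fin n, if (i : ℕ) < k then (α i : ℤ) else - (min k (α i) : ℕ)) - k * (k - 1)

lemma tvF_iff {n : ℕ} (α : Fin n → ℕ) (k : ℕ) : ErdosGallaiIneq α k ↔ tvF α k ≤ 0 := by
  unfold ErdosGallaiIneq tvF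
  rw [Finset.sum_ite, Finset.sum_neg_distrib]
  simp only [not_lt]
  zify
  have : ((k * (k - 1) : ℕ) : ℤ) = k * (k - 1) := by
    cases k <;> simp
  push_cast at this
  rw [this]
  constructor <;> intro h <;> linarith

def tvT {n : ℕ} (α : Fin n → ℕ) (k : ℕ) : ℤ :=
  ∑ i : Fin n, if k < (i : ℕ) ∧ k + 1 ≤ α i then 1 else 0

lemma tvF_succ {n : ℕ} (α : Fin n → ℕ) (k : Fin n) :
    tvF α (k + 1) - tvF α k = α k + (min (k : ℕ) (α k) : ℕ) - 2 * k - tvT α k := by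
  have e : ((α k : ℤ) + (min (k : ℕ) (α k) : ℕ)) =
      ∑ i : Fin n, if i = k then ((α k : ℤ) + (min (k : ℕ) (α k) : ℕ)) else 0 := by simp
  have : (∑ i : Fin n, if (i : ℕ) < k + 1 then (α i : ℤ) else - (min (k + 1) (α i) : ℕ))
      = (∑ i : Fin n, if (i : ℕ) < k then (α i : ℤ) else - (min (k : ℕ) (α i) : ℕ)) +
        (α k + (min (k : ℕ) (α k) : ℕ)) - tvT α k := by
    rw [e]
    unfold tvT
    rw [← Finset.sum_add_distrib, ← Finset.sum_sub_distrib]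
    refine Finset.sum_congr rfl fun i _ => ?_
    by_cases hik : i = k
    · subst hik; simp
    · have : (i : ℕ) ≠ k := fun h => hik (Fin.ext h)
      rw [if_neg hik]
      split_ifs <;> omega
  unfold tvF
  rw [this]
  push_cast
  ring

lemma tvT_succ {n : ℕ} (α : Fin n → ℕ) (k : ℕ) (hk : k + 1 < n) (h : k + 1 ≤ α ⟨k + 1, hk⟩) :
    tvT α (k + 1) + 1 ≤ tvT α k := by
  have e : (1 : ℤ) = ∑ i : Fin n, if i = ⟨k + 1, hk⟩ then 1 else 0 := by simp
  unfold tvT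
  refine (add_le_add_right e.le _).trans ?_
  rw [← Finset.sum_add_distrib]
  refine Finset.sum_le_sum fun i _ => ?_
  by_cases hi : i = ⟨k + 1, hk⟩
  · subst hi; simp [h]
  · rw [if_neg hi]
    split_ifs <;> omega

lemma tvT_nonneg {n : ℕ} (α : Fin n → ℕ) (k : ℕ) : 0 ≤ tvT α k :=
  Finset.sum_nonneg fun i _ => by split_ifs <;> simp

lemma tv_all {n : ℕ} (α : Fin n → ℕ) (hα : Antitone α)
    (H : ∀ (k : ℕ) (h1 : 1 ≤ k) (h2 : k ≤ n),
        (k = n ∨ ∃ (hk : k < n) (hk' : k - 1 < n), α ⟨k, hk⟩ < α ⟨k - 1, hk'⟩) →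
        tvF α k ≤ 0) (k : ℕ) (hk : k ≤ n) : tvF α k ≤ 0 := by
  have up : ∀ m j : ℕ, j + 1 ≤ n → n - j ≤ m → 0 < tvF α (j + 1) →
      tvF α j < tvF α (j + 1) → False := by
    intro m
    induction m with
    | zero => intro j h1 h2; omega
    | succ m ih =>
      intro j hj hm hpos hinc
      have hnd : ¬ (j + 1 = n ∨ ∃ (hk : j + 1 < n) (hk' : j + 1 - 1 < n),
          α ⟨j + 1, hk⟩ < α ⟨j + 1 - 1, hk'⟩) := by
        intro h
        have := H (j + 1) (by omega) hj h
        omega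
      push Not at hnd
      have hj' : j + 1 < n := by omega
      have heq : α ⟨j + 1, hj'⟩ = α ⟨j, hj⟩ :=
        le_antisymm (hα (Fin.le_def.2 (by simp))) (hnd.2 hj' hj)
      have d1 := tvF_succ α ⟨j, hj⟩
      have d2 := tvF_succ α ⟨j + 1, hj'⟩
      rw [heq] at d2
      simp only at d1 d2
      have t0 := tvT_nonneg α j
      have t2 := tvT_nonneg α (j + 1)
      have hc : j + 1 ≤ α ⟨j, hj⟩ := by omega
      have t1 := tvT_succ α j hj' (by omega)
      push_cast at d2
      exact ih (j + 1) (by omega) (by omega) (by omega) (by omega)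
  induction k with
  | zero => simp [tvF]
  | succ k ih =>
    have := ih (by omega)
    by_contra hc
    exact up _ k hk le_rfl (by omega) (by omega)

/-- Tripathi–Vijay: it suffices to check the Erdős–Gallai inequalities at indices
where the sequence strictly decreases (including the last index). -/
theorem stmt_5 {n : ℕ} (α : Fin n → ℕ) (hα : Antitone α) (heven : Even (∑ i, α i)) :
    IsGraphic α ↔
      ∀ (k : ℕ) (h1 : 1 ≤ k) (h2 : k ≤ n),
        (k = n ∨ ∃ hk : k < n, α ⟨k, hk⟩ < α ⟨k - 1, by omega⟩) →
        ErdosGallaiIneq α k := by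
  classical
  constructor
  · rintro ⟨G, inst, hG⟩ k _ hk _
    have : tvDeg G = α := by
      funext x
      rw [tvDeg_eq, hG]
    rw [← this]
    exact tv_necessary G k hk
  · intro H
    simp only [tvF_iff] at H
    obtain ⟨G, hG⟩ := tv_sufficient α hα heven
      (fun k _ hk => (tvF_iff α k).2 (tv_all α hα (fun k h1 h2 h => H k h1 h2
        (h.imp id fun ⟨hk, _, hh⟩ => ⟨hk, hh⟩)) k hk))
    exact ⟨G, inferInstance, fun i => by rw [← tvDeg_eq, hG]⟩
end

section
/- A nonincreasing sequence α = (α₁, ..., αₙ) of nonnegative integers with even sum is graphic if and only if the Erdős–Gallai inequality ∑_{i=1}^k αᵢ ≤ k(k-1) + ∑_{i=k+1}^n min(k, αᵢ) holds for every index k with α_k ≥ k. -/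
/-- Subset form of the Erdős–Gallai inequalities. -/
def EGSub {V : Type} [Fintype V] [DecidableEq V] (d : V → ℕ) : Prop :=
  ∀ S : Finset V, ∑ i ∈ S, d i ≤ S.card * (S.card - 1) + ∑ i ∈ Sᶜ, min S.card (d i)

/-- Realization with ncard degrees. -/
def HasDeg {V : Type} (G : SimpleGraph V) (d : V → ℕ) : Prop :=
  ∀ i, (G.neighborSet i).ncard = d i

theorem hasDeg_add {V : Type} [Fintype V] [DecidableEq V] (G : SimpleGraph V) (u v : V)
    (huv : u ≠ v) (h : ¬ G.Adj u v) (i : V) :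
    ((G ⊔ SimpleGraph.edge u v).neighborSet i).ncard =
      (G.neighborSet i).ncard + (if i = u then 1 else 0) + (if i = v then 1 else 0) := by
  by_cases hu : i = u
  · subst hu
    have : (G ⊔ SimpleGraph.edge i v).neighborSet i = insert v (G.neighborSet i) := by
      ext w
      simp only [SimpleGraph.mem_neighborSet, SimpleGraph.sup_adj, SimpleGraph.edge_adj,
        Set.mem_insert_iff]
      grind
    rw [this, Set.ncard_insert_of_notMem (by simpa using h) (Set.toFinite _)]
    simp [huv]
  · by_cases hv : i = v
    · subst hv
      have : (G ⊔ SimpleGraph.edge u i).neighborSet i = insert u (G.neighborSet i) := by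
        ext w
        simp only [SimpleGraph.mem_neighborSet, SimpleGraph.sup_adj, SimpleGraph.edge_adj,
          Set.mem_insert_iff]
        grind
      rw [this, Set.ncard_insert_of_notMem
        (by simpa using fun h' => h (SimpleGraph.Adj.symm h')) (Set.toFinite _)]
      simp [hu]
    · have : (G ⊔ SimpleGraph.edge u v).neighborSet i = G.neighborSet i := by
        ext w
        simp only [SimpleGraph.mem_neighborSet, SimpleGraph.sup_adj, SimpleGraph.edge_adj]
        grind
      rw [this]; simp [hu, hv]

theorem exists_del {V : Type} [Fintype V] [DecidableEq V] (G : SimpleGraph V) (u v : V)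
    (h : G.Adj u v) : ∃ H : SimpleGraph V, H ≤ G ∧ ¬ H.Adj u v ∧
      ∀ i, (G.neighborSet i).ncard =
      (H.neighborSet i).ncard + (if i = u then 1 else 0) + (if i = v then 1 else 0) := by
  refine ⟨G.deleteEdges {s(u, v)}, SimpleGraph.deleteEdges_le _, by simp, ?_⟩
  intro i
  rw [← hasDeg_add _ u v h.ne (by simp)]
  congr 2
  ext a b
  simp only [SimpleGraph.sup_adj, SimpleGraph.edge_adj, SimpleGraph.deleteEdges_adj,
    Set.mem_singleton_iff, Sym2.eq_iff]
  have := h.symm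
  have := h.ne
  grind

/-- The main step: EG passes to the reduced sequence. -/
theorem EGSub_step {V : Type} [Fintype V] [DecidableEq V] (d d' : V → ℕ) (u v : V)
    (huv : u ≠ v) (hd : ∀ i, d i = d' i + (if i = u then 1 else 0) + (if i = v then 1 else 0))
    (hmax : ∀ i, d i ≤ d u) (heven : Even (∑ i, d i)) (h : EGSub d) : EGSub d' := by
  intro S
  set k := S.card with hk
  have hS := h S
  rw [← hk] at hS
  have sumS : ∑ i ∈ S, d i = ∑ i ∈ S, d' i + (if u ∈ S then 1 else 0)
      + (if v ∈ S then 1 else 0) := by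
    simp [hd, Finset.sum_add_distrib]
  have sumC : ∑ i ∈ Sᶜ, d i = ∑ i ∈ Sᶜ, d' i + (if u ∈ S then 0 else 1)
      + (if v ∈ S then 0 else 1) := by
    simp only [hd, Finset.sum_add_distrib, Finset.sum_ite_eq', Finset.mem_compl]
    grind
  have minC : ∑ i ∈ Sᶜ, min k (d i) ≤ ∑ i ∈ Sᶜ, min k (d' i) + (if u ∈ S then 0 else 1)
      + (if v ∈ S then 0 else 1) := by
    calc _ ≤ ∑ i ∈ Sᶜ, (min k (d' i) + (if i = u then 1 else 0) + (if i = v then 1 else 0)) := by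
          apply Finset.sum_le_sum; intro i _; rw [hd i]; grind
      _ = _ := by
          simp only [Finset.sum_add_distrib, Finset.sum_ite_eq', Finset.mem_compl]
          grind
  by_cases hu : u ∈ S
  · grind
  by_cases hv : v ∈ S
  · grind
  simp only [hu, hv, if_false] at sumS sumC minC
  have hSD : ∑ i ∈ S, d i ≤ k * d u := by
    have := Finset.sum_le_card_nsmul S d (d u) (fun i _ => hmax i)
    simpa [hk] using this
  have hvpos : 1 ≤ d v := by have := hd v; simp at this; omega
  have hupos : 1 ≤ d u := by have := hd u; simp at this; omega
  have hsplit : ∑ i ∈ S, d i + ∑ i ∈ Sᶜ, d i = ∑ i, d i := Finset.sum_add_sum_compl S d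
  have hu' : u ∈ Sᶜ := by simpa using hu
  have hv' : v ∈ Sᶜ.erase u := by simp [huv.symm, hv]
  rcases lt_trichotomy (d u) k with hlt | heq | hgt
  · have : k * d u ≤ k * (k - 1) := Nat.mul_le_mul_left _ (by omega)
    omega
  · have e1 : ∑ i ∈ Sᶜ, min k (d i) = ∑ i ∈ Sᶜ, d i :=
      Finset.sum_congr rfl (fun i _ => min_eq_right (heq ▸ hmax i))
    have e2 : ∑ i ∈ Sᶜ, min k (d' i) = ∑ i ∈ Sᶜ, d' i :=
      Finset.sum_congr rfl (fun i _ => min_eq_right (by have := hmax i; have := hd i; omega))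
    have e3 : d u + d v ≤ ∑ i ∈ Sᶜ, d i := by
      rw [← Finset.add_sum_erase _ _ hu']
      have := Finset.single_le_sum (f := d) (fun i _ => Nat.zero_le _) hv'
      omega
    have e4 : Even (k * (k - 1)) := Nat.even_mul_pred_self k
    have e5 : k * d u = k * (k - 1) + k := by
      rw [heq]; cases k <;> simp; ring
    obtain ⟨a, ha⟩ := e4
    obtain ⟨b, hb⟩ := heven
    omega
  · by_contra hcon
    have hdu' : k ≤ d' u := by have := hd u; simp [huv] at this; omega
    -- sharper bound
    have minC1 : ∑ i ∈ Sᶜ, min k (d i) ≤ ∑ i ∈ Sᶜ, min k (d' i) +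
        (if d v ≤ k then 1 else 0) := by
      calc _ ≤ ∑ i ∈ Sᶜ, (min k (d' i) + (if i = v then (if d v ≤ k then 1 else 0) else 0)) := by
            apply Finset.sum_le_sum; intro i _
            have := hd i
            by_cases h1 : i = u
            · subst h1; simp [hdu']
            · by_cases h2 : i = v
              · subst h2
                simp [h1] at this ⊢
                split_ifs <;> omega
              · simp [h1, h2] at this ⊢; omega
        _ = _ := by
            simp only [Finset.sum_add_distrib, Finset.sum_ite_eq', Finset.mem_compl]
            simp [hv]
    have hvk : d v ≤ k := by
      by_contra hc
      simp [hc] at minC1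
      omega
    simp [hvk] at minC1
    have tight : ∑ i ∈ S, d i = k * (k - 1) + ∑ i ∈ Sᶜ, min k (d i) := by omega
    have hk1 : 1 ≤ k := by omega
    have hSu := h (insert u S)
    rw [Finset.sum_insert hu, Finset.card_insert_of_notMem hu, Finset.compl_insert, ← hk,
      Nat.add_sub_cancel] at hSu
    set r := ∑ i ∈ Sᶜ.erase u, (if k < d i then 1 else 0) with hr
    have m1 : ∑ i ∈ Sᶜ.erase u, min (k+1) (d i) = ∑ i ∈ Sᶜ.erase u, min k (d i) + r := by
      rw [hr, ← Finset.sum_add_distrib]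
      apply Finset.sum_congr rfl; intro i _; split_ifs <;> omega
    have m2 : ∑ i ∈ Sᶜ, min k (d i) = k + ∑ i ∈ Sᶜ.erase u, min k (d i) := by
      rw [← Finset.add_sum_erase _ _ hu', min_eq_left hgt.le]
    have m3 : k * r + 1 ≤ ∑ i ∈ Sᶜ.erase u, min k (d i) := by
      have : ∑ i ∈ Sᶜ.erase u, (k * (if k < d i then 1 else 0) + if i = v then 1 else 0)
          ≤ ∑ i ∈ Sᶜ.erase u, min k (d i) := by
        apply Finset.sum_le_sum; intro i _
        by_cases h2 : i = v
        · subst h2; simp; split_ifs <;> omega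
        · simp [h2]; split_ifs <;> omega
      rw [Finset.sum_add_distrib, ← Finset.mul_sum, Finset.sum_ite_eq', if_pos hv'] at this
      exact this
    have kk : (k+1) * k = k * (k-1) + 2 * k := by
      obtain ⟨j, hj⟩ : ∃ j, k = j + 1 := ⟨k - 1, by omega⟩
      rw [hj, Nat.add_sub_cancel]; ring
    have m4 : d u ≤ k + r := by omega
    have m5 : k * d u ≤ k * (k + r) := Nat.mul_le_mul_left _ m4
    have m6 : k * (k + r) = k * (k-1) + k + k * r := by
      obtain ⟨j, hj⟩ : ∃ j, k = j + 1 := ⟨k - 1, by omega⟩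
      rw [hj, Nat.add_sub_cancel]; ring
    omega

theorem graph_step {V : Type} [Fintype V] [DecidableEq V] (d d' : V → ℕ) (u v : V)
    (huv : u ≠ v) (hd : ∀ i, d i = d' i + (if i = u then 1 else 0) + (if i = v then 1 else 0))
    (hmin : ∀ i, 0 < d i → d v ≤ d i)
    (hu : d u ≤ ∑ i ∈ ({u} : Finset V)ᶜ, min 1 (d i))
    (G : SimpleGraph V) (hG : HasDeg G d') : ∃ G : SimpleGraph V, HasDeg G d := by
  by_cases hadj : G.Adj u v
  · -- find m
    have hcard : ∑ i ∈ ({u} : Finset V)ᶜ, min 1 (d i)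
        = (({u} : Finset V)ᶜ.filter (fun i => 0 < d i)).card := by
      rw [Finset.card_filter]
      apply Finset.sum_congr rfl; intro i _; split_ifs <;> omega
    have hm : ∃ m, m ≠ u ∧ 0 < d m ∧ ¬ G.Adj u m := by
      by_contra hc
      push Not at hc
      have h1 : (((({u} : Finset V)ᶜ.filter (fun i => 0 < d i)) : Finset V) : Set V).ncard ≤
          (G.neighborSet u).ncard := by
        apply Set.ncard_le_ncard _ (Set.toFinite _)
        intro i hi
        simp at hi
        exact hc i hi.1 hi.2
      rw [Set.ncard_coe_finset, hG u] at h1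
      have := hd u
      simp at this
      omega
    obtain ⟨m, hmu, hmpos, hmadj⟩ := hm
    have hmv : m ≠ v := by rintro rfl; exact hmadj hadj
    have hk : ∃ k, G.Adj m k ∧ k ≠ v ∧ ¬ G.Adj v k := by
      by_contra hc
      push Not at hc
      have h1 : (G.neighborSet m).ncard ≤ (insert v (G.neighborSet v \ {u})).ncard := by
        apply Set.ncard_le_ncard _ (Set.toFinite _)
        intro k hk
        by_cases hkv : k = v
        · left; exact hkv
        · right
          refine ⟨hc k hk hkv, ?_⟩
          rintro rfl
          exact hmadj (SimpleGraph.Adj.symm hk)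
      have h2 := Set.ncard_insert_le v (G.neighborSet v \ {u})
      have h3 := Set.ncard_sdiff_singleton_add_one (s := G.neighborSet v) (a := u) hadj.symm
        (Set.toFinite _)
      rw [hG v] at h3
      rw [hG m] at h1
      have a1 := hd v
      have a2 := hd m
      have a3 := hmin m hmpos
      simp [hmu, hmv, huv.symm] at a1 a2
      omega
    obtain ⟨k, hmk, hkv, hvk⟩ := hk
    have hku : k ≠ u := by rintro rfl; exact hmadj hmk.symm
    obtain ⟨H, hHG, hH1, hH2⟩ := exists_del G m k hmk
    have hum : ¬ H.Adj u m := fun h => hmadj (hHG h)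
    have hkv' : ¬ (H ⊔ SimpleGraph.edge u m).Adj k v := by
      simp only [SimpleGraph.sup_adj, SimpleGraph.edge_adj]
      have : ¬ H.Adj k v := fun h => hvk (hHG h).symm
      have := hmk.ne
      grind
    refine ⟨(H ⊔ SimpleGraph.edge u m) ⊔ SimpleGraph.edge k v, fun i => ?_⟩
    rw [hasDeg_add _ _ _ hkv hkv', hasDeg_add _ _ _ hmu.symm hum, hd i, ← hG i, hH2 i]
    ring
  · exact ⟨G ⊔ SimpleGraph.edge u v, fun i => by rw [hasDeg_add _ _ _ huv hadj, hd i, hG i]⟩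

theorem EGSub_suff {V : Type} [Fintype V] [DecidableEq V] (N : ℕ) : ∀ (d : V → ℕ),
    ∑ i, d i = N → Even (∑ i, d i) → EGSub d → ∃ G : SimpleGraph V, HasDeg G d := by
  induction N using Nat.strong_induction_on with
  | _ N ih =>
  intro d hN heven h
  by_cases hz : ∀ i, d i = 0
  · refine ⟨⊥, fun i => ?_⟩
    have : (⊥ : SimpleGraph V).neighborSet i = ∅ := by ext w; simp
    rw [this, hz]; simp
  push Not at hz
  obtain ⟨w, hw⟩ := hz
  obtain ⟨u, -, hmax⟩ := Finset.exists_max_image Finset.univ d ⟨w, Finset.mem_univ w⟩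
  have hupos : 0 < d u := by have := hmax w (Finset.mem_univ w); omega
  have hu : d u ≤ ∑ i ∈ ({u} : Finset V)ᶜ, min 1 (d i) := by
    have := h {u}; simpa using this
  have hne : (({u} : Finset V)ᶜ.filter (fun i => 0 < d i)).Nonempty := by
    by_contra hc
    rw [Finset.not_nonempty_iff_eq_empty, Finset.filter_eq_empty_iff] at hc
    have : ∑ i ∈ ({u} : Finset V)ᶜ, min 1 (d i) = 0 :=
      Finset.sum_eq_zero (fun i hi => by have := hc hi; omega)
    omega
  obtain ⟨v, hv, hmin⟩ := Finset.exists_min_image _ d hne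
  simp at hv hmin
  have huv : u ≠ v := fun e => hv.1 e.symm
  have hd : ∀ i, d i = (d i - (if i = u then 1 else 0) - (if i = v then 1 else 0))
      + (if i = u then 1 else 0) + (if i = v then 1 else 0) := by
    intro i
    grind
  set d' : V → ℕ := fun i => d i - (if i = u then 1 else 0) - (if i = v then 1 else 0) with hd'
  have hd2 : ∀ i, d i = d' i + (if i = u then 1 else 0) + (if i = v then 1 else 0) := hd
  have hsum : ∑ i, d i = ∑ i, d' i + 1 + 1 := by
    rw [Finset.sum_congr rfl (fun i _ => hd2 i)]
    simp [Finset.sum_add_distrib]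
  obtain ⟨G, hG⟩ := ih (∑ i, d' i) (by omega) d' rfl
    (by obtain ⟨b, hb⟩ := heven; exact ⟨b - 1, by omega⟩)
    (EGSub_step d d' u v huv hd2 (fun i => hmax i (Finset.mem_univ i)) heven h)
  refine graph_step d d' u v huv hd2 (fun i hi => ?_) hu G hG
  by_cases e : i = u
  · subst e; exact hmax v (Finset.mem_univ v)
  · exact hmin i e hi

theorem EGSub_nec {V : Type} [Fintype V] [DecidableEq V] (G : SimpleGraph V) [DecidableRel G.Adj] :
    EGSub (fun i => G.degree i) := by
  intro S
  have h1 : ∑ i ∈ S, G.degree i = ∑ j, (G.neighborFinset j ∩ S).card := by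
    have a : ∀ i, G.degree i = ∑ j, if G.Adj i j then 1 else 0 := by
      intro i; rw [← Finset.card_filter, ← SimpleGraph.card_neighborFinset_eq_degree]
      congr 1; ext; simp
    have b : ∀ j, (G.neighborFinset j ∩ S).card = ∑ i ∈ S, if G.Adj i j then 1 else 0 := by
      intro j; rw [← Finset.card_filter]
      congr 1; ext x; simp [G.adj_comm, and_comm]
    simp only [a, b]
    exact Finset.sum_comm
  rw [h1, ← Finset.sum_add_sum_compl S]
  apply Nat.add_le_add
  · rw [← smul_eq_mul]
    apply Finset.sum_le_card_nsmul
    intro j hj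
    rw [← Finset.card_erase_of_mem hj]
    apply Finset.card_le_card
    intro x hx
    simp at hx ⊢
    exact ⟨hx.1.ne', hx.2⟩
  · apply Finset.sum_le_sum
    intro j _
    apply le_min
    · exact Finset.card_le_card Finset.inter_subset_right
    · show _ ≤ G.degree j
      rw [← SimpleGraph.card_neighborFinset_eq_degree]
      exact Finset.card_le_card Finset.inter_subset_left

theorem sum_le_initial {n : ℕ} (f : Fin n → ℕ) (hf : Antitone f) (S : Finset (Fin n)) :
    ∑ i ∈ S, f i ≤ ∑ i ∈ Finset.univ.filter (fun i : Fin n => (i : ℕ) < S.card), f i := by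
  rcases Nat.eq_zero_or_pos S.card with h0 | hpos
  · rw [Finset.card_eq_zero] at h0; subst h0; simp
  have hkn : S.card ≤ n := by simpa using Finset.card_le_univ S
  set k := S.card with hk
  set I := Finset.univ.filter (fun i : Fin n => (i : ℕ) < k) with hI
  have hIc : I.card = k := by
    rw [hI, Fin.card_filter_val_lt]; omega
  have hc : (S \ I).card = (I \ S).card := Finset.card_sdiff_comm (by omega)
  have e1 := Finset.sum_inter_add_sum_sdiff S I f
  have e2 := Finset.sum_inter_add_sum_sdiff I S f
  have a1 : ∑ x ∈ S \ I, f x ≤ _ := Finset.sum_le_card_nsmul (S \ I) f (f ⟨k - 1, by omega⟩) (by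
    intro x hx
    apply hf
    simp [hI] at hx
    rw [Fin.le_def]; simp; omega)
  have a2 : _ ≤ ∑ x ∈ I \ S, f x := Finset.card_nsmul_le_sum (I \ S) f (f ⟨k - 1, by omega⟩) (by
    intro x hx
    apply hf
    simp [hI] at hx
    rw [Fin.le_def]; simp; omega)
  rw [Finset.inter_comm] at e2
  rw [hc] at a1
  omega

theorem EG_all {n : ℕ} (α : Fin n → ℕ)
    (h : ∀ (k : ℕ) (_ : 1 ≤ k) (_ : k ≤ n) (h3 : k - 1 < n),
        k ≤ α ⟨k - 1, h3⟩ → ErdosGallaiIneq α k) (k : ℕ) (hk : k ≤ n) :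
    ErdosGallaiIneq α k := by
  induction k with
  | zero => simp [ErdosGallaiIneq]
  | succ k ih =>
    by_cases hc : k + 1 ≤ α ⟨k, by omega⟩
    · exact h (k+1) (by omega) hk (by omega) hc
    have ih := ih (by omega)
    unfold ErdosGallaiIneq at ih ⊢
    have f1 : Finset.univ.filter (fun i : Fin n => (i : ℕ) < k + 1) =
        insert ⟨k, by omega⟩ (Finset.univ.filter (fun i : Fin n => (i : ℕ) < k)) := by
      ext x; simp [Fin.ext_iff]; omega
    have f2 : Finset.univ.filter (fun i : Fin n => k ≤ (i : ℕ)) =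
        insert ⟨k, by omega⟩ (Finset.univ.filter (fun i : Fin n => k + 1 ≤ (i : ℕ))) := by
      ext x; simp [Fin.ext_iff]; omega
    rw [f1, Finset.sum_insert (by simp)]
    rw [f2, Finset.sum_insert (by simp)] at ih
    have f3 : ∑ i ∈ Finset.univ.filter (fun i : Fin n => k + 1 ≤ (i : ℕ)), min k (α i) ≤
      ∑ i ∈ Finset.univ.filter (fun i : Fin n => k + 1 ≤ (i : ℕ)), min (k+1) (α i) :=
      Finset.sum_le_sum (fun i _ => by omega)
    have kk : (k + 1) * (k + 1 - 1) = k * (k - 1) + 2 * k := by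
      cases k with
      | zero => rfl
      | succ j => simp only [Nat.add_sub_cancel]; ring
    omega

theorem EG_to_sub {n : ℕ} (α : Fin n → ℕ) (hα : Antitone α)
    (h : ∀ k ≤ n, ErdosGallaiIneq α k) : EGSub α := by
  intro S
  have hkn : S.card ≤ n := by simpa using Finset.card_le_univ S
  have h1 := h _ hkn
  unfold ErdosGallaiIneq at h1
  have h2 := sum_le_initial (fun i => α i + min S.card (α i))
    (fun a b hab => by have := hα hab; simp only; omega) S
  rw [Finset.sum_add_distrib, Finset.sum_add_distrib] at h2
  have h3 := Finset.sum_add_sum_compl S (fun i => min S.card (α i))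
  have h4 := Finset.sum_filter_add_sum_filter_not Finset.univ
    (fun i : Fin n => (i : ℕ) < S.card) (fun i => min S.card (α i))
  simp only [not_lt] at h4
  omega

theorem stmt_6 {n : ℕ} (α : Fin n → ℕ) (hα : Antitone α) (heven : Even (∑ i, α i)) :
    IsGraphic α ↔
      ∀ (k : ℕ) (h1 : 1 ≤ k) (h2 : k ≤ n),
        k ≤ α ⟨k - 1, by omega⟩ → ErdosGallaiIneq α k := by
  constructor
  · rintro ⟨G, inst, hG⟩ k h1 h2 -
    have h := EGSub_nec G
    have e : (fun i => G.degree i) = α := funext hG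
    rw [e] at h
    have h3 := h (Finset.univ.filter (fun i : Fin n => (i : ℕ) < k))
    have hIc : (Finset.univ.filter (fun i : Fin n => (i : ℕ) < k)).card = k := by
      rw [Fin.card_filter_val_lt]; omega
    rw [hIc, Finset.compl_filter] at h3
    simp only [not_lt] at h3
    exact h3
  · intro h
    obtain ⟨G, hG⟩ := EGSub_suff _ α rfl heven (EG_to_sub α hα (EG_all α (fun k h1 h2 _ => h k h1 h2)))
    classical
    refine ⟨G, inferInstance, fun i => ?_⟩
    rw [← hG i, ← SimpleGraph.card_neighborSet_eq_degree, ← Nat.card_eq_fintype_card]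
    rfl
end
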